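/- Suppose K ⊆ S and d ∈ W satisfy d⁻¹(Δ_K) ⊆ Δ, i.e. for every s ∈ K one has d⁻¹sd ∈ S and ℓ(d⁻¹s) = ℓ(d⁻¹) + 1; for a subset L ⊆ K write L^d = d⁻¹Ld ⊆ S. Then: (a) x_{K^d} = x_K · d in ℂW; (b) m^σ_{I^d J^d} = m^σ_{IJ} for all I ⊆ J ⊆ K; and (c) e^σ_{L^d} = e^σ_L · d for all L ⊆ K. -/

import Mathlib

open scoped Classical
open MonoidAlgebra Finset

noncomputable section

namespace DPR

variable {B : Type} {W : Type} [Group W] [Fintype W] [DecidableEq W]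
  {M : CoxeterMatrix B}

/-- The set `S` of simple reflections of the Coxeter system, as a finset of `W`. -/
def Simples (cs : CoxeterSystem M W) : Finset W :=
  Finset.univ.filter (fun w => ∃ i, cs.simple i = w)

/-- The set `W^I` of minimal length left coset representatives of `W_I`,
computed inside the subset `H` of `W` (take `H = Set.univ` for the absolute case). -/
def minCoset (cs : CoxeterSystem M W) (H : Set W) (I : Finset W) : Finset W :=
  Finset.univ.filter (fun w => w ∈ H ∧ ∀ s ∈ I, cs.length w < cs.length (w * s))

/-- The element `x_I = ∑_{w ∈ W^I} w` of the group algebra `ℂ W`, relative to `H`. -/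
def xRel (cs : CoxeterSystem M W) (H : Set W) (I : Finset W) : MonoidAlgebra ℂ W :=
  ∑ w ∈ minCoset cs H I, of ℂ W w

/-- `w(Δ_J) ⊆ Δ_D`:  for every `s ∈ J`, `wsw⁻¹ ∈ D` and `ℓ(ws) = ℓ(w) + 1`. -/
def Takes (cs : CoxeterSystem M W) (D : Finset W) (w : W) (J : Finset W) : Prop :=
  ∀ s ∈ J, w * s * w⁻¹ ∈ D ∧ cs.length (w * s) = cs.length w + 1

/-- `ᵂJ = wJw⁻¹`. -/
def conjF (w : W) (J : Finset W) : Finset W := J.image (fun s => w * s * w⁻¹)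

/-- The coefficient `m^σ_{JK}`, computed relative to the pair `(H, D)`
(`H = Set.univ`, `D = S` in the absolute case). -/
def mC (cs : CoxeterSystem M W) (H : Set W) (D : Finset W) (σ : Finset W → ℝ)
    (J K : Finset W) : ℝ :=
  if J ⊆ K then
    ∑ w ∈ (minCoset cs H K).filter (fun w => Takes cs D w J), σ (conjF w J)
  else 0

/-- The family `(e_J)` is a family of BBHT quasi-idempotents, relative to `(H, D, σ)`:
it solves the defining triangular system `x_K = ∑_{J ⊆ K} m^σ_{JK} e_J` for all `K ⊆ D`. -/
def IsBBHT (cs : CoxeterSystem M W) (H : Set W) (D : Finset W) (σ : Finset W → ℝ)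
    (e : Finset W → MonoidAlgebra ℂ W) : Prop :=
  ∀ K ∈ D.powerset, xRel cs H K = ∑ J ∈ K.powerset, (mC cs H D σ J K : ℂ) • e J

/-- `σ` takes positive values (on subsets of `D`). -/
def PosOn (D : Finset W) (σ : Finset W → ℝ) : Prop := ∀ I ∈ D.powerset, 0 < σ I

/-- Two subsets of `S` have the same shape if the parabolic subgroups they generate
are conjugate in `W`. -/
def ShapeEq (I J : Finset W) : Prop :=
  ∃ w : W, Subgroup.closure (J : Set W) =
    Subgroup.map (MulAut.conj w).toMonoidHom (Subgroup.closure (I : Set W))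

/-- Solomon's descent algebra, as a subspace of the group algebra: the span of the `x_I`. -/
def descAlg (cs : CoxeterSystem M W) : Submodule ℂ (MonoidAlgebra ℂ W) :=
  Submodule.span ℂ {a | ∃ I ∈ (Simples cs).powerset, a = xRel cs Set.univ I}

section ReflectionCocycle

variable {B' W' : Type*} [Group W'] {M' : CoxeterMatrix B'}

/-- The permutation `(t, ε) ↦ (s t s, ε + [t = s])` attached to an involution `s`. -/
def signedConj (s : W') (hs : s * s = 1) : Equiv.Perm (W' × ZMod 2) :=
  Function.Involutive.toPerm (fun p => (s * p.1 * s, p.2 + if p.1 = s then 1 else 0)) (by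
    rintro ⟨t, ε⟩
    have h1 : s * (s * t * s) * s = t := by
      rw [show s * (s * t * s) * s = (s * s) * t * (s * s) by group, hs]; simp
    have h2 : s * t * s = s ↔ t = s := by
      constructor
      · intro h
        rw [← h1, h, hs, one_mul]
      · rintro rfl
        rw [hs, one_mul]
    ext
    · exact h1
    · simp only [h2]
      split_ifs
      · rw [add_assoc, CharTwo.add_self_eq_zero, add_zero]
      · simp)

lemma signedConj_apply (s : W') (hs : s * s = 1) (p : W' × ZMod 2) :
    signedConj s hs p = (s * p.1 * s, p.2 + if p.1 = s then 1 else 0) := rfl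

lemma signedConj_mul_pow_apply (a b : W') (ha : a * a = 1) (hb : b * b = 1) (n : ℕ)
    (t : W') (ε : ZMod 2) :
    ((signedConj a ha * signedConj b hb) ^ n) (t, ε) =
      ((a * b) ^ n * t * ((a * b) ^ n)⁻¹,
        ε + ∑ k ∈ range (2 * n), if t = b * (a * b) ^ k then 1 else 0) := by
  have hai : a⁻¹ = a := inv_eq_of_mul_eq_one_left ha
  have hbi : b⁻¹ = b := inv_eq_of_mul_eq_one_left hb
  have hconj : ∀ k : ℕ, ((a * b) ^ k)⁻¹ * b = b * (a * b) ^ k := by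
    intro k
    have : SemiconjBy b (a * b) (a * b)⁻¹ := by
      simp [SemiconjBy, mul_assoc, hai, hbi]
    have := this.pow_right k
    rw [inv_pow] at this
    exact this.symm
  induction n with
  | zero => simp
  | succ n ih =>
    rw [pow_succ', Equiv.Perm.mul_apply, ih, Equiv.Perm.mul_apply, signedConj_apply,
      signedConj_apply, show 2 * (n + 1) = 2 * n + 1 + 1 by ring, sum_range_succ,
      sum_range_succ]
    set x := a * b with hx
    have e1 : x ^ n * t * (x ^ n)⁻¹ = b ↔ t = b * x ^ (2 * n) := by
      rw [two_mul, pow_add, ← mul_assoc, ← hconj, mul_inv_eq_iff_eq_mul, ← eq_inv_mul_iff_mul_eq,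
        mul_assoc]
    have e2 : b * (x ^ n * t * (x ^ n)⁻¹) * b = a ↔ t = b * x ^ (2 * n + 1) := by
      have : b * x ^ (2 * n + 1) = (x ^ n)⁻¹ * (b * x) * x ^ n := by
        rw [← mul_assoc, hconj, show 2 * n + 1 = n + 1 + n by ring, pow_add, pow_succ]
        group
      rw [this, ← eq_mul_inv_iff_mul_eq, ← eq_inv_mul_iff_mul_eq, hbi,
        mul_inv_eq_iff_eq_mul, ← eq_inv_mul_iff_mul_eq]
      simp only [mul_assoc, hx]
    simp only [e1, e2]
    ext
    · simp only
      rw [pow_succ' x n, mul_inv_rev x, hx, mul_inv_rev a b, hai, hbi]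
      simp only [mul_assoc]
    · simp only [add_assoc]

lemma isLiftable_signedConj (cs : CoxeterSystem M' W') :
    M'.IsLiftable (fun i => signedConj (cs.simple i) (cs.simple_mul_simple_self i)) := by
  intro i j
  ext1 ⟨t, ε⟩
  rw [signedConj_mul_pow_apply, cs.simple_mul_simple_pow, two_mul, sum_range_add]
  simp [pow_add, CharTwo.add_self_eq_zero]

/-- The action of `W` on pairs (element, sign) extending `signedConj` on simple reflections. -/
def signedAction (cs : CoxeterSystem M' W') : W' →* Equiv.Perm (W' × ZMod 2) :=
  cs.lift ⟨_, isLiftable_signedConj cs⟩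

/-- The reflection cocycle: for a reflection `t`, it detects whether `t` is a right inversion
of `w`. -/
def inversionSign (cs : CoxeterSystem M' W') (w t : W') : ZMod 2 :=
  (signedAction cs w (t, 0)).2

lemma signedAction_simple (cs : CoxeterSystem M' W') (i : B') :
    signedAction cs (cs.simple i) =
      signedConj (cs.simple i) (cs.simple_mul_simple_self i) := by
  simp [signedAction]

lemma signedAction_apply (cs : CoxeterSystem M' W') (w t : W') (ε : ZMod 2) :
    signedAction cs w (t, ε) = (w * t * w⁻¹, ε + inversionSign cs w t) := by
  have key : ∀ w : W', ∀ t : W', ∃ c : ZMod 2, ∀ ε : ZMod 2,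
      signedAction cs w (t, ε) = (w * t * w⁻¹, ε + c) := by
    intro w
    induction w using cs.simple_induction_left with
    | one => exact fun t => ⟨0, by simp⟩
    | mul_simple_left w i ih =>
      intro t
      obtain ⟨c, hc⟩ := ih t
      refine ⟨c + if w * t * w⁻¹ = cs.simple i then 1 else 0, fun ε => ?_⟩
      rw [map_mul, Equiv.Perm.mul_apply, hc, signedAction_simple, signedConj_apply]
      simp [mul_assoc, add_assoc]
  obtain ⟨c, hc⟩ := key w t
  rw [inversionSign, hc, hc, zero_add]

lemma inversionSign_mul (cs : CoxeterSystem M' W') (v w t : W') :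
    inversionSign cs (v * w) t = inversionSign cs w t + inversionSign cs v (w * t * w⁻¹) := by
  rw [inversionSign, map_mul, Equiv.Perm.mul_apply, signedAction_apply, signedAction_apply,
    zero_add]

lemma inversionSign_simple (cs : CoxeterSystem M' W') (i : B') (t : W') :
    inversionSign cs (cs.simple i) t = if t = cs.simple i then 1 else 0 := by
  simp [inversionSign, signedAction_simple, signedConj_apply]

lemma mem_rightInvSeq_of_inversionSign_ne_zero (cs : CoxeterSystem M' W') (ω : List B') (t : W')
    (h : inversionSign cs (cs.wordProd ω) t ≠ 0) : t ∈ cs.rightInvSeq ω := by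
  induction ω with
  | nil => simp [inversionSign] at h
  | cons i ω ih =>
    rw [cs.wordProd_cons, inversionSign_mul, inversionSign_simple] at h
    rw [CoxeterSystem.rightInvSeq, List.mem_cons]
    by_cases h0 : inversionSign cs (cs.wordProd ω) t = 0
    · left
      rw [h0, zero_add, ne_eq, ite_eq_right_iff, Classical.not_imp] at h
      rw [← h.1]
      group
    · exact Or.inr (ih h0)

lemma length_mul_lt_of_inversionSign_ne_zero (cs : CoxeterSystem M' W') (w t : W')
    (h : inversionSign cs w t ≠ 0) : cs.length (w * t) < cs.length w := by
  obtain ⟨ω, hω, rfl⟩ := cs.exists_isReduced w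
  exact (cs.isRightInversion_of_mem_rightInvSeq hω
    (mem_rightInvSeq_of_inversionSign_ne_zero cs ω t h)).2

lemma inversionSign_eq_zero_iff (cs : CoxeterSystem M' W') (w : W') (i : B') :
    inversionSign cs w (cs.simple i) = 0 ↔ cs.length w < cs.length (w * cs.simple i) := by
  constructor
  · intro h
    have h1 : inversionSign cs (w * cs.simple i) (cs.simple i) ≠ 0 := by
      rw [inversionSign_mul, inversionSign_simple]
      simp [h]
    simpa using length_mul_lt_of_inversionSign_ne_zero cs _ _ h1
  · intro h
    by_contra h0
    exact lt_asymm h (length_mul_lt_of_inversionSign_ne_zero cs _ _ h0)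

end ReflectionCocycle

lemma mem_simples_iff {cs : CoxeterSystem M W} {w : W} :
    w ∈ Simples cs ↔ ∃ i, cs.simple i = w := by
  simp [Simples]

section Conjugation

variable {G : Type} [Group G] [DecidableEq G]

lemma conjF_mono (w : G) {I J : Finset G} (h : I ⊆ J) : conjF w I ⊆ conjF w J :=
  image_subset_image h

lemma conjF_conjF (v w : G) (J : Finset G) : conjF v (conjF w J) = conjF (v * w) J := by
  simp [conjF, image_image, Function.comp_def, mul_assoc]

lemma conjF_injective (w : G) : Function.Injective (conjF w) :=
  image_injective (MulAut.conj w).injective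

lemma powerset_conjF (w : G) (L : Finset G) :
    (conjF w L).powerset = L.powerset.image (conjF w) :=
  powerset_image

end Conjugation

lemma Takes.mono {cs : CoxeterSystem M W} {D : Finset W} {w : W} {I J : Finset W}
    (h : Takes cs D w J) (hIJ : I ⊆ J) : Takes cs D w I :=
  fun s hs => h s (hIJ hs)

lemma Takes.conjF_subset {cs : CoxeterSystem M W} {D : Finset W} {w : W} {J : Finset W}
    (h : Takes cs D w J) : conjF w J ⊆ D :=
  image_subset_iff.2 fun s hs => (h s hs).1

lemma length_mul_eq_succ_iff (cs : CoxeterSystem M W) {w s : W} (hs : s ∈ Simples cs) :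
    cs.length (w * s) = cs.length w + 1 ↔ cs.length w < cs.length (w * s) := by
  obtain ⟨i, rfl⟩ := mem_simples_iff.1 hs
  rcases cs.length_mul_simple w i with h | h <;> omega

/-- If `d` carries the simple root of `d⁻¹ s d` to that of `s`, then right ascents `s` of `v`
correspond to right ascents `d⁻¹ s d` of `v d`. -/
lemma length_lt_length_mul_conj_iff (cs : CoxeterSystem M W) {d s : W} (hs : s ∈ Simples cs)
    (hd : Takes cs (Simples cs) d⁻¹ {s}) (v : W) :
    cs.length (v * d) < cs.length (v * d * (d⁻¹ * s * d⁻¹⁻¹)) ↔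
      cs.length v < cs.length (v * s) := by
  obtain ⟨hr, hlen⟩ := hd s (mem_singleton_self s)
  obtain ⟨i, rfl⟩ := mem_simples_iff.1 hs
  obtain ⟨j, hj⟩ := mem_simples_iff.1 hr
  have hdj : inversionSign cs d (cs.simple j) = 0 := by
    rw [inversionSign_eq_zero_iff, hj, ← cs.length_inv d, ← cs.length_inv (d * _)]
    simp [mul_assoc] at hlen ⊢
    omega
  rw [← hj, ← inversionSign_eq_zero_iff, inversionSign_mul, hdj, zero_add, hj,
    ← inversionSign_eq_zero_iff]
  simp [mul_assoc]

section Translation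

variable {cs : CoxeterSystem M W} {K : Finset W} {d : W}

lemma mul_mem_minCoset_conjF_iff (hK : K ⊆ Simples cs) (hd : Takes cs (Simples cs) d⁻¹ K)
    (w : W) :
    w * d ∈ minCoset cs Set.univ (conjF d⁻¹ K) ↔ w ∈ minCoset cs Set.univ K := by
  simp only [minCoset, mem_filter, mem_univ, Set.mem_univ, true_and, conjF, forall_mem_image]
  exact forall₂_congr fun s hs =>
    length_lt_length_mul_conj_iff cs (hK hs) (hd.mono (singleton_subset_iff.2 hs)) w

lemma takes_mul_conjF_iff (hK : K ⊆ Simples cs) (hd : Takes cs (Simples cs) d⁻¹ K) (w : W) :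
    Takes cs (Simples cs) (w * d) (conjF d⁻¹ K) ↔ Takes cs (Simples cs) w K := by
  simp only [Takes, conjF, forall_mem_image]
  refine forall₂_congr fun s hs => ?_
  rw [length_mul_eq_succ_iff cs (hd s hs).1, length_mul_eq_succ_iff cs (hK hs),
    length_lt_length_mul_conj_iff cs (hK hs) (hd.mono (singleton_subset_iff.2 hs)) w]
  simp [mul_assoc]

lemma xRel_conjF (hK : K ⊆ Simples cs) (hd : Takes cs (Simples cs) d⁻¹ K) :
    xRel cs Set.univ (conjF d⁻¹ K) = xRel cs Set.univ K * of ℂ W d := by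
  rw [xRel, xRel, sum_mul]
  refine (sum_equiv (Equiv.mulRight d) (fun w => ?_) fun w _ => ?_).symm
  · exact (mul_mem_minCoset_conjF_iff hK hd w).symm
  · rw [Equiv.coe_mulRight, map_mul]

lemma mC_conjF (σ : Finset W → ℝ) {I : Finset W} (hI : I ⊆ K) (hK : K ⊆ Simples cs)
    (hd : Takes cs (Simples cs) d⁻¹ K) :
    mC cs Set.univ (Simples cs) σ (conjF d⁻¹ I) (conjF d⁻¹ K)
      = mC cs Set.univ (Simples cs) σ I K := by
  rw [mC, mC, if_pos (conjF_mono _ hI), if_pos hI]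
  refine (sum_equiv (Equiv.mulRight d) (fun w => ?_) fun w _ => ?_).symm
  · simp only [mem_filter, Equiv.coe_mulRight, mul_mem_minCoset_conjF_iff hK hd,
      takes_mul_conjF_iff (hI.trans hK) (hd.mono hI)]
  · rw [Equiv.coe_mulRight, conjF_conjF, mul_inv_cancel_right]

lemma mC_self_pos {σ : Finset W → ℝ} (hσ : PosOn (Simples cs) σ) (hK : K ⊆ Simples cs) :
    0 < mC cs Set.univ (Simples cs) σ K K := by
  rw [mC, if_pos Subset.rfl]
  refine sum_pos (fun w hw => hσ _ (mem_powerset.2 (mem_filter.1 hw).2.conjF_subset)) ⟨1, ?_⟩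
  have h1 : ∀ s ∈ K, cs.length s = 1 := fun s hs => by
    obtain ⟨i, rfl⟩ := mem_simples_iff.1 (hK hs)
    exact cs.length_simple i
  simp +contextual [minCoset, Takes, h1, @hK _]

lemma isBBHT_conjF {σ : Finset W → ℝ} (hσ : PosOn (Simples cs) σ)
    {e : Finset W → MonoidAlgebra ℂ W} (he : IsBBHT cs Set.univ (Simples cs) σ e)
    (hK : K ⊆ Simples cs) (hd : Takes cs (Simples cs) d⁻¹ K) :
    e (conjF d⁻¹ K) = e K * of ℂ W d := by
  induction K using Finset.strongInduction with
  | H L ih =>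
    have h1 := he L (mem_powerset.2 hK)
    have h2 := he (conjF d⁻¹ L) (mem_powerset.2 hd.conjF_subset)
    rw [xRel_conjF hK hd, h1, powerset_conjF, sum_image (conjF_injective _).injOn, sum_mul,
      ← add_sum_erase _ _ (mem_powerset_self L), ← add_sum_erase _ _ (mem_powerset_self L),
      mC_conjF σ Subset.rfl hK hd] at h2
    have h3 : ∀ J ∈ L.powerset.erase L,
        (mC cs Set.univ (Simples cs) σ J L : ℂ) • e J * of ℂ W d =
          (mC cs Set.univ (Simples cs) σ (conjF d⁻¹ J) (conjF d⁻¹ L) : ℂ) • e (conjF d⁻¹ J) := by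
      intro J hJ
      rw [mem_erase, mem_powerset] at hJ
      rw [mC_conjF σ hJ.2 hK hd, ih J (hJ.2.ssubset_of_ne hJ.1) (hJ.2.trans hK) (hd.mono hJ.2),
        smul_mul_assoc]
    rw [sum_congr rfl h3, add_left_inj, smul_mul_assoc] at h2
    exact (smul_right_injective _
      (Complex.ofReal_ne_zero.2 (mC_self_pos hσ hK).ne') h2).symm

end Translation

/-- Lemma 3.1 (translation properties of `x`, `m` and `e`):
if `K ⊆ S` and `d⁻¹(Δ_K) ⊆ Δ`, then `x_{K^d} = x_K d`, `m^σ_{I^d J^d} = m^σ_{IJ}`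
for `I ⊆ J ⊆ K`, and `e^σ_{L^d} = e^σ_L d` for `L ⊆ K`. -/
theorem stmt0 (cs : CoxeterSystem M W) (σ : Finset W → ℝ) (hσ : PosOn (Simples cs) σ)
    (e : Finset W → MonoidAlgebra ℂ W) (he : IsBBHT cs Set.univ (Simples cs) σ e)
    (K : Finset W) (hK : K ⊆ Simples cs) (d : W)
    (hd : Takes cs (Simples cs) d⁻¹ K) :
    (xRel cs Set.univ (conjF d⁻¹ K) = xRel cs Set.univ K * of ℂ W d) ∧
    (∀ I J : Finset W, I ⊆ J → J ⊆ K →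
      mC cs Set.univ (Simples cs) σ (conjF d⁻¹ I) (conjF d⁻¹ J)
        = mC cs Set.univ (Simples cs) σ I J) ∧
    (∀ L : Finset W, L ⊆ K → e (conjF d⁻¹ L) = e L * of ℂ W d) := by
  exact ⟨xRel_conjF hK hd,
    fun I J hI hJ => mC_conjF σ hI (hJ.trans hK) (hd.mono hJ),
    fun L hL => isBBHT_conjF hσ he (hL.trans hK) (hd.mono hL)⟩

end DPR
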